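/- arXiv:1607.04915 — 3 statements merged into one kernel-verified Lean document; each statement's English description precedes it below -/
import Mathlib

section
/- The orbit of the point 0 ∈ ℝ under the natural action of the subgroup F of Equiv.Perm ℝ generated by {a, b} is exactly the set Γ of dyadic rationals: {f(0) | f ∈ F} = Γ. -/
noncomputable section

/-- The generator `a` of Thompson's group `F`: translation `x ↦ x - 1`. -/
def a : Equiv.Perm ℝ where
  toFun x := x - 1
  invFun x := x + 1
  left_inv x := by ring
  right_inv x := by ring

/-- The generator `b` of Thompson's group `F`. -/
def b : Equiv.Perm ℝ where
  toFun x := if x ≤ 0 then x else if x ≤ 2 then x / 2 else x - 1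
  invFun x := if x ≤ 0 then x else if x ≤ 1 then 2 * x else x + 1
  left_inv x := by
    dsimp only
    split_ifs <;> linarith
  right_inv x := by
    dsimp only
    split_ifs <;> linarith

/-- Thompson's group `F`, as a subgroup of `Equiv.Perm ℝ`. -/
def F : Subgroup (Equiv.Perm ℝ) := Subgroup.closure {a, b}

/-- The set of dyadic rationals. -/
def Γ : Set ℝ := {x : ℝ | ∃ m : ℤ, ∃ k : ℕ, x = m / 2 ^ k}

theorem a_apply (x : ℝ) : a x = x - 1 := rfl

theorem b_apply_of_mem_Icc {x : ℝ} (h0 : 0 ≤ x) (h2 : x ≤ 2) : b x = x / 2 := by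
  change (if x ≤ 0 then x else if x ≤ 2 then x / 2 else x - 1) = x / 2
  split_ifs <;> linarith

theorem half_mem_Γ_iff {x : ℝ} : x / 2 ∈ Γ ↔ x ∈ Γ := by
  constructor
  · rintro ⟨m, k, h⟩
    refine ⟨2 * m, k, ?_⟩
    rw [div_eq_iff two_ne_zero] at h
    rw [h]
    push_cast
    ring
  · rintro ⟨m, k, rfl⟩
    exact ⟨m, k + 1, by rw [pow_succ, div_div]⟩

theorem sub_one_mem_Γ_iff {x : ℝ} : x - 1 ∈ Γ ↔ x ∈ Γ := by
  constructor
  · rintro ⟨m, k, h⟩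
    refine ⟨m + 2 ^ k, k, ?_⟩
    push_cast
    rw [add_div, div_self (by positivity), ← h]
    ring
  · rintro ⟨m, k, rfl⟩
    refine ⟨m - 2 ^ k, k, ?_⟩
    push_cast
    rw [sub_div, div_self (by positivity)]

theorem b_mem_Γ_iff {x : ℝ} : b x ∈ Γ ↔ x ∈ Γ := by
  change (if x ≤ 0 then x else if x ≤ 2 then x / 2 else x - 1) ∈ Γ ↔ x ∈ Γ
  split_ifs
  · rfl
  · exact half_mem_Γ_iff
  · exact sub_one_mem_Γ_iff

theorem apply_mem_Γ_iff {f : Equiv.Perm ℝ} (hf : f ∈ F) (x : ℝ) : f x ∈ Γ ↔ x ∈ Γ := by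
  induction hf using Subgroup.closure_induction generalizing x with
  | mem f hf =>
    obtain rfl | rfl := hf
    · exact sub_one_mem_Γ_iff
    · exact b_mem_Γ_iff
  | one => rfl
  | mul f g _ _ hf hg => exact (hf (g x)).trans (hg x)
  | inv f _ hf => rw [← hf (f⁻¹ x), show f (f⁻¹ x) = x from f.apply_symm_apply x]

theorem a_mem_F : a ∈ F := Subgroup.subset_closure (Or.inl rfl)

theorem b_mem_F : b ∈ F := Subgroup.subset_closure (Or.inr rfl)

/-- `F` contains all integer translations. -/
theorem exists_mem_F_apply_eq_add_int (n : ℤ) : ∃ g ∈ F, ∀ x : ℝ, g x = x + n := by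
  induction n with
  | zero => exact ⟨1, F.one_mem, fun x => by simp⟩
  | succ n ih =>
    obtain ⟨g, hg, h⟩ := ih
    refine ⟨a⁻¹ * g, F.mul_mem (F.inv_mem a_mem_F) hg, fun x => ?_⟩
    rw [Equiv.Perm.mul_apply, Equiv.Perm.inv_eq_iff_eq, h, a_apply]
    push_cast
    ring
  | pred n ih =>
    obtain ⟨g, hg, h⟩ := ih
    refine ⟨a * g, F.mul_mem a_mem_F hg, fun x => ?_⟩
    rw [Equiv.Perm.mul_apply, h, a_apply]
    push_cast
    ring

theorem exists_mem_F_apply_zero_eq_div_two_pow (k : ℕ) (m : ℤ) :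
    ∃ f ∈ F, f 0 = (m : ℝ) / 2 ^ k := by
  induction k generalizing m with
  | zero =>
    obtain ⟨g, hg, h⟩ := exists_mem_F_apply_eq_add_int m
    exact ⟨g, hg, by simp [h]⟩
  | succ k ih =>
    have hpos : (0 : ℤ) < 2 ^ (k + 1) := by positivity
    obtain ⟨f, hf, hf0⟩ := ih (m % 2 ^ (k + 1))
    obtain ⟨g, hg, h⟩ := exists_mem_F_apply_eq_add_int (m / 2 ^ (k + 1))
    have hr0 : (0 : ℝ) ≤ (m % 2 ^ (k + 1) : ℤ) := by
      exact_mod_cast Int.emod_nonneg m hpos.ne'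
    have hr1 : ((m % 2 ^ (k + 1) : ℤ) : ℝ) ≤ 2 ^ (k + 1) := by
      exact_mod_cast (Int.emod_lt_of_pos m hpos).le
    have hm : (m : ℝ) = (m % 2 ^ (k + 1) : ℤ) + 2 ^ (k + 1) * (m / 2 ^ (k + 1) : ℤ) := by
      exact_mod_cast (Int.emod_add_mul_ediv m (2 ^ (k + 1))).symm
    refine ⟨g * (b * f), F.mul_mem hg (F.mul_mem b_mem_F hf), ?_⟩
    rw [Equiv.Perm.mul_apply, Equiv.Perm.mul_apply, h, hf0, b_apply_of_mem_Icc (by positivity)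
      (by rw [div_le_iff₀ (by positivity)]; linarith [pow_succ (2 : ℝ) k]), hm, add_div,
      mul_div_cancel_left₀ _ (by positivity), div_div, ← pow_succ]

/-- The orbit of `0 : ℝ` under Thompson's group `F` is exactly the set of
dyadic rationals. -/
theorem orbit_zero_eq_dyadics :
    {x : ℝ | ∃ f ∈ F, f 0 = x} = Γ := by
  ext x
  constructor
  · rintro ⟨f, hf, rfl⟩
    exact (apply_mem_Γ_iff hf 0).2 ⟨0, 0, by simp⟩
  · rintro ⟨m, k, rfl⟩
    exact exists_mem_F_apply_zero_eq_div_two_pow k m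
end
end

section
/- The action of F on the dyadic rationals is highly transitive in the following sense: for every pair of finite subsets V, W ⊆ Γ with the same cardinality, there exists f ∈ F such that f(V) = W. -/
noncomputable section

theorem a_zpow_apply (k : ℤ) (x : ℝ) : (a ^ k) x = x - k := by
  have a_apply (y : ℝ) : a y = y - 1 := rfl
  have a_inv_apply (y : ℝ) : a⁻¹ y = y + 1 := rfl
  induction k generalizing x with
  | zero => simp
  | succ n ih => rw [zpow_add_one, Equiv.Perm.mul_apply, ih, a_apply]; push_cast; ring
  | pred n ih => rw [zpow_sub_one, Equiv.Perm.mul_apply, ih, a_inv_apply]; push_cast; ring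

theorem b_apply (x : ℝ) : b x = if x ≤ 0 then x else if x ≤ 2 then x / 2 else x - 1 := rfl

theorem b_inv_apply (x : ℝ) :
    b⁻¹ x = if x ≤ 0 then x else if x ≤ 1 then 2 * x else x + 1 := rfl

/-- The conjugate of `g` by the translation by `k`. -/
def shiftConj (k : ℤ) (g : Equiv.Perm ℝ) : Equiv.Perm ℝ := a ^ (-k) * g * a ^ k

theorem shiftConj_apply (k : ℤ) (g : Equiv.Perm ℝ) (x : ℝ) :
    shiftConj k g x = g (x - k) + k := by
  simp [shiftConj, Equiv.Perm.mul_apply, a_zpow_apply, -zpow_neg]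

theorem shiftConj_mem_F (k : ℤ) {g : Equiv.Perm ℝ} (hg : g ∈ F) : shiftConj k g ∈ F :=
  F.mul_mem (F.mul_mem (F.zpow_mem a_mem_F _) hg) (F.zpow_mem a_mem_F _)

theorem sub_one_mem_Γ {x : ℝ} (hx : x ∈ Γ) : x - 1 ∈ Γ := by
  obtain ⟨m, k, rfl⟩ := hx
  exact ⟨m - 2 ^ k, k, by push_cast; field_simp⟩

theorem add_one_mem_Γ {x : ℝ} (hx : x ∈ Γ) : x + 1 ∈ Γ := by
  obtain ⟨m, k, rfl⟩ := hx
  exact ⟨m + 2 ^ k, k, by push_cast; field_simp⟩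

theorem half_mem_Γ {x : ℝ} (hx : x ∈ Γ) : x / 2 ∈ Γ := by
  obtain ⟨m, k, rfl⟩ := hx
  exact ⟨m, k + 1, by rw [pow_succ]; field_simp⟩

theorem two_mul_mem_Γ {x : ℝ} (hx : x ∈ Γ) : 2 * x ∈ Γ := by
  obtain ⟨m, k, rfl⟩ := hx
  exact ⟨2 * m, k, by push_cast; ring⟩

theorem a_apply_mem_Γ_iff (x : ℝ) : a x ∈ Γ ↔ x ∈ Γ :=
  ⟨fun h => a.symm_apply_apply x ▸ add_one_mem_Γ h, sub_one_mem_Γ⟩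

theorem b_apply_mem_Γ_iff (x : ℝ) : b x ∈ Γ ↔ x ∈ Γ := by
  rw [b_apply]
  split_ifs
  · rfl
  · exact ⟨fun h => by simpa [mul_div_cancel₀] using two_mul_mem_Γ h, half_mem_Γ⟩
  · exact ⟨fun h => by simpa using add_one_mem_Γ h, sub_one_mem_Γ⟩

theorem mem_Γ_iff_of_mem_F {f : Equiv.Perm ℝ} (hf : f ∈ F) : ∀ x, f x ∈ Γ ↔ x ∈ Γ := by
  induction hf using Subgroup.closure_induction with
  | mem g hg =>
    rcases hg with rfl | rfl
    exacts [a_apply_mem_Γ_iff, b_apply_mem_Γ_iff]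
  | one => simp
  | mul g h _ _ ihg ihh => intro x; rw [Equiv.Perm.mul_apply, ihg, ihh]
  | inv g _ ih => intro x; simpa using (ih (g⁻¹ x)).symm

theorem strictMono_of_mem_F {f : Equiv.Perm ℝ} (hf : f ∈ F) : StrictMono f := by
  induction hf using Subgroup.closure_induction with
  | mem g hg =>
    rcases hg with rfl | rfl
    · exact fun x y h => sub_lt_sub_right h 1
    · intro x y h
      rw [b_apply, b_apply]
      split_ifs <;> linarith
  | one => exact strictMono_id
  | mul g h _ _ ihg ihh => exact ihg.comp ihh
  | inv g _ ih =>
    intro x y h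
    rw [← ih.lt_iff_lt]
    simpa using h

theorem exists_mem_F_apply_eq_int (K : ℕ) (k m : ℤ) (hk : (k : ℝ) < m / 2 ^ K) :
    ∃ g ∈ F, (∀ y ≤ (k : ℝ), g y = y) ∧ ∃ n : ℤ, g (m / 2 ^ K) = n := by
  induction K generalizing m with
  | zero => exact ⟨1, F.one_mem, fun _ _ => rfl, m, by simp⟩
  | succ K ih =>
    set x : ℝ := m / 2 ^ (K + 1) with hx
    set j : ℤ := ⌊x⌋
    have hjx : (j : ℝ) ≤ x := Int.floor_le x
    have hxj : x < j + 1 := Int.lt_floor_add_one x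
    have hkj : (k : ℝ) ≤ j := by exact_mod_cast Int.le_floor.2 hk.le
    have h_eq : ((m - j * 2 ^ K : ℤ) : ℝ) / 2 ^ K = 2 * x - j := by
      rw [hx, pow_succ]; push_cast; field_simp
    have h_apply : shiftConj j b⁻¹ x = ((m - j * 2 ^ K : ℤ) : ℝ) / 2 ^ K := by
      rw [h_eq, shiftConj_apply, b_inv_apply]
      split_ifs <;> linarith
    obtain ⟨g, hg, hfix, n, hn⟩ := ih (m - j * 2 ^ K) (by rw [h_eq]; linarith)
    refine ⟨g * shiftConj j b⁻¹, F.mul_mem hg (shiftConj_mem_F j (F.inv_mem b_mem_F)),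
      fun y hy => ?_, n, ?_⟩
    · rw [Equiv.Perm.mul_apply, shiftConj_apply, b_inv_apply, if_pos (by linarith),
        sub_add_cancel, hfix y hy]
    · rw [Equiv.Perm.mul_apply, h_apply, hn]

theorem exists_mem_F_apply_add_nat (k : ℤ) (N : ℕ) :
    ∃ g ∈ F, (∀ y ≤ (k : ℝ), g y = y) ∧ g (k + 1 + N) = k + 1 := by
  induction N with
  | zero => exact ⟨1, F.one_mem, fun _ _ => rfl, by simp⟩
  | succ N ih =>
    obtain ⟨g, hg, hfix, hN⟩ := ih
    refine ⟨g * shiftConj k b, F.mul_mem hg (shiftConj_mem_F k b_mem_F), fun y hy => ?_, ?_⟩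
    · rw [Equiv.Perm.mul_apply, shiftConj_apply, b_apply, if_pos (by linarith),
        sub_add_cancel, hfix y hy]
    · have h_apply : shiftConj k b (k + 1 + (N + 1 : ℕ)) = k + 1 + N := by
        have hN0 : (0 : ℝ) ≤ N := N.cast_nonneg
        rw [shiftConj_apply, b_apply]
        push_cast
        split_ifs <;> linarith
      rw [Equiv.Perm.mul_apply, h_apply, hN]

/-- The pointwise stabilizer in `F` of `(-∞, k]` moves every dyadic `x > k` to `k + 1`. -/
theorem exists_mem_F_apply_eq_add_one (k : ℤ) {x : ℝ} (hx : x ∈ Γ) (hk : (k : ℝ) < x) :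
    ∃ g ∈ F, (∀ y ≤ (k : ℝ), g y = y) ∧ g x = k + 1 := by
  obtain ⟨m, K, rfl⟩ := hx
  obtain ⟨g, hg, hfix, n, hn⟩ := exists_mem_F_apply_eq_int K k m hk
  have hkn : k < n := by
    have := strictMono_of_mem_F hg hk
    rw [hfix k le_rfl, hn] at this
    exact_mod_cast this
  obtain ⟨N, rfl⟩ : ∃ N : ℕ, n = k + 1 + N := ⟨(n - (k + 1)).toNat, by omega⟩
  obtain ⟨h, hh, h_fix, hN⟩ := exists_mem_F_apply_add_nat k N
  refine ⟨h * g, F.mul_mem hh hg, fun y hy => ?_, ?_⟩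
  · rw [Equiv.Perm.mul_apply, hfix y hy, h_fix y hy]
  · rw [Equiv.Perm.mul_apply, hn]
    exact_mod_cast hN

theorem exists_mem_F_image_eq_range (V : Finset ℝ) (hV : ↑V ⊆ Γ) :
    ∃ f ∈ F, f '' (V : Set ℝ) = (fun n : ℕ => (n : ℝ)) '' (Finset.range V.card : Set ℕ) := by
  induction V using Finset.induction_on_max with
  | empty => exact ⟨1, F.one_mem, by simp⟩
  | insert x V hmax ih =>
    rw [Finset.coe_insert, Set.insert_subset_iff] at hV
    obtain ⟨f, hf, hfV, hfx⟩ : ∃ f ∈ F,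
        f '' (V : Set ℝ) = (fun n : ℕ => (n : ℝ)) '' (Finset.range V.card : Set ℕ) ∧
        (((V.card : ℤ) - 1 : ℤ) : ℝ) < f x := by
      rcases V.eq_empty_or_nonempty with rfl | hne
      · refine ⟨a ^ ⌊x⌋, F.zpow_mem a_mem_F _, by simp, ?_⟩
        have := Int.floor_le x
        rw [a_zpow_apply]
        push_cast [Finset.card_empty]
        linarith
      · obtain ⟨f, hf, hfV⟩ := ih hV.2
        have hpos := hne.card_pos
        have h_mem : ((V.card - 1 : ℕ) : ℝ) ∈ f '' (V : Set ℝ) := by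
          rw [hfV]
          exact ⟨V.card - 1, by simpa using hpos, rfl⟩
        obtain ⟨v, hv, hvx⟩ := h_mem
        refine ⟨f, hf, hfV, ?_⟩
        have := strictMono_of_mem_F hf (hmax v hv)
        rw [hvx, Nat.cast_sub hpos] at this
        exact_mod_cast this
    obtain ⟨g, hg, hfix, hgx⟩ :=
      exists_mem_F_apply_eq_add_one _ ((mem_Γ_iff_of_mem_F hf x).2 hV.1) hfx
    refine ⟨g * f, F.mul_mem hg hf, ?_⟩
    have hg_range : g '' ((fun n : ℕ => (n : ℝ)) '' (Finset.range V.card : Set ℕ)) =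
        (fun n : ℕ => (n : ℝ)) '' (Finset.range V.card : Set ℕ) := by
      rw [Set.image_image]
      refine Set.image_congr fun n hn => hfix _ ?_
      have hn' : n < V.card := by simpa using hn
      have : (n : ℤ) ≤ (V.card : ℤ) - 1 := by omega
      exact_mod_cast this
    rw [Finset.card_insert_of_notMem fun h => (hmax x h).false, Finset.range_add_one,
      Finset.coe_insert, Finset.coe_insert, Set.image_insert_eq, Set.image_insert_eq,
      Equiv.Perm.mul_apply, hgx, Equiv.Perm.coe_mul, Set.image_comp, hfV, hg_range]
    congr 1
    push_cast
    ring

/-- The action of Thompson's group `F` on the dyadic rationals is highly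
transitive: any finite subset of `Γ` can be mapped onto any other finite
subset of `Γ` of the same cardinality by an element of `F`. -/
theorem F_highly_transitive :
    ∀ V W : Finset ℝ, ↑V ⊆ Γ → ↑W ⊆ Γ → V.card = W.card →
      ∃ f ∈ F, (⇑f) '' ↑V = ↑W := by
  intro V W hV hW hcard
  obtain ⟨f, hf, hfV⟩ := exists_mem_F_image_eq_range V hV
  obtain ⟨g, hg, hgW⟩ := exists_mem_F_image_eq_range W hW
  refine ⟨g⁻¹ * f, F.mul_mem (F.inv_mem hg) hf, ?_⟩
  rw [Equiv.Perm.coe_mul, Set.image_comp, hfV, hcard, ← hgW, ← Set.image_comp,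
    ← Equiv.Perm.coe_mul, inv_mul_cancel, Equiv.Perm.coe_one, Set.image_id]
end
end

section
/- Thompson's group F is not strongly amenable: there exists a nonempty compact Hausdorff topological space X together with an action of F on X such that each group element acts as a homeomorphism, the action is proximal (for every x, y ∈ X there exists p ∈ X with (p, p) in the closure of {(g • x, g • y) | g ∈ F} in X × X), and the action has no fixed point (for every x ∈ X there exists g ∈ F with g • x ≠ x). -/
noncomputable section

open Set Topology
open scoped Pointwise

section StronglyIrreducible

variable {G : Type}

/-- The set of places where a configuration takes the value `true`. -/
def trueSet (x : G → Bool) : Set G := {g | x g = true}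

theorem trueSet_boolIndicator (M : Set G) : trueSet M.boolIndicator = M := by
  ext g
  exact (Set.mem_iff_boolIndicator M g).symm

theorem isClopen_eval_true {X : Type} [TopologicalSpace X] {f : X → G → Bool}
    (hf : Continuous f) (g : G) : IsClopen {p | g ∈ trueSet (f p)} :=
  (isClopen_discrete {true}).preimage ((continuous_apply g).comp hf)

theorem isClopen_exists_mem {X : Type} [TopologicalSpace X] {B : Set G} (hB : B.Finite)
    {p : G → X → Prop} (hp : ∀ g, IsClopen {x | p g x}) : IsClopen {x | ∃ g ∈ B, p g x} := by
  have : {x | ∃ g ∈ B, p g x} = ⋃ g ∈ B, {x | p g x} := by ext; simp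
  rw [this]
  exact hB.isClopen_biUnion fun g _ => hp g

variable [Group G]

/-- The sets `E i` are pairwise `D`-far apart. -/
def FarApart {ι : Type} (D : Set G) (E : ι → Set G) : Prop :=
  ∀ i j, i ≠ j → ∀ e ∈ E i, ∀ e' ∈ E j, e⁻¹ * e' ∉ D

theorem FarApart.mono {ι : Type} {D D' : Set G} {E : ι → Set G} (h : FarApart D E)
    (hD : D' ⊆ D) : FarApart D' E :=
  fun i j hij e he e' he' hd => h i j hij e he e' he' (hD hd)

theorem FarApart.mul {ι : Type} {D A : Set G} {E : ι → Set G}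
    (h : FarApart (A * D * A⁻¹) E) : FarApart D (fun i => E i * A) := by
  rintro i j hij _ ⟨e, he, x, hx, rfl⟩ _ ⟨e', he', y, hy, rfl⟩ hd
  refine h i j hij e he e' he' ?_
  have := Set.mul_mem_mul (Set.mul_mem_mul hx hd) (Set.inv_mem_inv.2 hy)
  convert this using 1
  group

/-- A strongly irreducible subshift of `G → Bool`: patterns on sets that are far apart can be
combined freely. -/
structure IsStronglyIrreducible (S : Set (G → Bool)) : Prop where
  isClosed : IsClosed S
  translate_mem : ∀ g, ∀ x ∈ S, (fun h => x (g * h)) ∈ S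
  exists_glue : ∃ D : Set G, D.Finite ∧ ∀ (ι : Type) (E : ι → Set G) (x : ι → G → Bool),
    (∀ i, x i ∈ S) → FarApart D E → ∃ z ∈ S, ∀ i, ∀ e ∈ E i, z e = x i e

theorem IsStronglyIrreducible.nonempty {S : Set (G → Bool)} (hS : IsStronglyIrreducible S) :
    S.Nonempty := by
  obtain ⟨D, -, hD⟩ := hS.exists_glue
  obtain ⟨z, hz, -⟩ := hD Empty Empty.elim Empty.elim (fun i => i.elim) (fun i => i.elim)
  exact ⟨z, hz⟩

/-- `M` is a maximal `B`-separated subset of the complement of `Z`. -/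
structure IsSaturated (B Z M : Set G) : Prop where
  notMem : ∀ m ∈ M, m ∉ Z
  sep : ∀ m ∈ M, ∀ b ∈ B, m * b ∈ M → b = 1
  sat : ∀ h, h ∉ Z → ∃ b ∈ B, h * b ∈ M

theorem IsSaturated.translate {B Z M : Set G} (h : IsSaturated B Z M) (g : G) :
    IsSaturated B {k | g * k ∈ Z} {k | g * k ∈ M} where
  notMem m hm := h.notMem _ hm
  sep m hm b hb hmb := h.sep _ hm b hb (by simpa [mul_assoc] using hmb)
  sat k hk := by simpa [mul_assoc] using h.sat _ hk

theorem exists_isSaturated_superset {B Z N : Set G} (h1 : 1 ∈ B) (hinv : B⁻¹ = B)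
    (hN : ∀ m ∈ N, m ∉ Z) (hsep : ∀ m ∈ N, ∀ b ∈ B, m * b ∈ N → b = 1) :
    ∃ M, N ⊆ M ∧ IsSaturated B Z M := by
  obtain ⟨M, hNM, hM⟩ := zorn_subset_nonempty
    {M : Set G | (∀ m ∈ M, m ∉ Z) ∧ ∀ m ∈ M, ∀ b ∈ B, m * b ∈ M → b = 1}
    (by
      intro c hc hchain hne
      refine ⟨⋃₀ c, ⟨?_, ?_⟩, fun s hs => subset_sUnion_of_mem hs⟩
      · rintro m ⟨s, hs, hm⟩
        exact (hc hs).1 m hm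
      · rintro m ⟨s, hs, hm⟩ b hb ⟨t, ht, hmb⟩
        rcases hchain.total hs ht with hst | hst
        · exact (hc ht).2 m (hst hm) b hb hmb
        · exact (hc hs).2 m hm b hb (hst hmb))
    N ⟨hN, hsep⟩
  refine ⟨M, hNM, hM.prop.1, hM.prop.2, fun h hh => ?_⟩
  by_contra! hcon
  have hhM : h ∉ M := by simpa using hcon 1 h1
  have hmem : insert h M ∈ {M : Set G | (∀ m ∈ M, m ∉ Z) ∧
      ∀ m ∈ M, ∀ b ∈ B, m * b ∈ M → b = 1} := by
    refine ⟨?_, ?_⟩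
    · rintro m (rfl | hm)
      · exact hh
      · exact hM.prop.1 m hm
    · rintro m (rfl | hm) b hb (hmb | hmb)
      · simpa using hmb
      · exact absurd hmb (hcon b hb)
      · refine absurd ?_ (hcon b⁻¹ (by rw [← hinv]; simpa using hb))
        rw [← hmb]
        simpa using hm
      · exact hM.prop.2 m hm b hb hmb
  exact hhM (hM.le_of_ge hmem (subset_insert _ _) (mem_insert _ _))

theorem exists_isSaturated_glue {ι : Type} {B Z : Set G} {E Zi Mi : ι → Set G} (h1 : 1 ∈ B)
    (hinv : B⁻¹ = B) (hE : FarApart (B * B * B⁻¹) E) (hM : ∀ i, IsSaturated B (Zi i) (Mi i))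
    (hZ : ∀ i, ∀ e ∈ E i * B, e ∈ Z ↔ e ∈ Zi i) :
    ∃ M, IsSaturated B Z M ∧ ∀ i, ∀ e ∈ E i, e ∈ M ↔ e ∈ Mi i := by
  obtain ⟨M, hNM, hsat⟩ := exists_isSaturated_superset (Z := Z)
    (N := {g | ∃ i, g ∈ E i * B ∧ g ∈ Mi i}) h1 hinv
    (by
      rintro m ⟨i, hmE, hm⟩ hmZ
      exact (hM i).notMem m hm ((hZ i m hmE).1 hmZ))
    (by
      rintro m ⟨i, hmE, hm⟩ b hb ⟨j, hmbE, hmb⟩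
      by_cases hij : i = j
      · subst hij
        exact (hM i).sep m hm b hb hmb
      · exact absurd (by simpa using hb) (hE.mul i j hij _ hmE _ hmbE))
  have hsub : ∀ i, ∀ e ∈ E i, e ∈ E i * B := fun i e he => ⟨e, he, 1, h1, mul_one e⟩
  refine ⟨M, hsat, fun i e he => ⟨fun heM => ?_, fun heM => hNM ⟨i, hsub i e he, heM⟩⟩⟩
  obtain ⟨b, hb, heb⟩ := (hM i).sat e
    (fun h => hsat.notMem e heM ((hZ i e (hsub i e he)).2 h))
  have hb1 : b = 1 := hsat.sep e heM b hb (hNM ⟨i, ⟨e, he, b, hb, rfl⟩, heb⟩)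
  simpa [hb1] using heb

/-- `V` is a union of translates `m * C`, `m ∈ M₁`, and `m * C'`, `m ∈ M₂`, where `M₂` is a maximal
`L`-separated set and `M₁` is a maximal `B`-separated set among the places compatible with `M₂`. -/
structure IsTiling (L B T C C' V M₁ M₂ : Set G) : Prop where
  snd : IsSaturated L ∅ M₂
  fst : IsSaturated B {h | ∃ t ∈ T, h * t ∈ M₂} M₁
  mem_iff : ∀ g, g ∈ V ↔ (∃ c ∈ C, g * c⁻¹ ∈ M₁) ∨ ∃ c ∈ C', g * c⁻¹ ∈ M₂

/-- The configurations that come from tilings. -/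
def tilings (L B T C C' : Set G) : Set (G → Bool) :=
  {x | ∃ y z : G → Bool, IsTiling L B T C C' (trueSet x) (trueSet y) (trueSet z)}

theorem isClosed_isSaturated {X : Type} [TopologicalSpace X] {B : Set G} (hB : B.Finite)
    {f : X → G → Bool} (hf : Continuous f) {Z : X → Set G}
    (hZ : ∀ h, IsClopen {p | h ∈ Z p}) : IsClosed {p | IsSaturated B (Z p) (trueSet (f p))} := by
  have key : {p | IsSaturated B (Z p) (trueSet (f p))} =
      (⋂ m, ({p | m ∈ trueSet (f p)} ∩ {p | m ∈ Z p})ᶜ) ∩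
      (⋂ m, ⋂ b, ⋂ (_ : b ∈ B ∧ b ≠ 1),
        ({p | m ∈ trueSet (f p)} ∩ {p | m * b ∈ trueSet (f p)})ᶜ) ∩
      ⋂ h, ({p | h ∈ Z p} ∪ {p | ∃ b ∈ B, h * b ∈ trueSet (f p)}) := by
    ext p
    simp only [mem_inter_iff, mem_iInter, mem_compl_iff, mem_ofPred_eq, mem_union]
    constructor
    · intro h
      refine ⟨⟨fun m hm => h.notMem m hm.1 hm.2, fun m b hb hm => hb.2 (h.sep m hm.1 b hb.1 hm.2)⟩,
        fun k => ?_⟩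
      by_cases hk : k ∈ Z p
      · exact Or.inl hk
      · exact Or.inr (h.sat k hk)
    · rintro ⟨⟨h1, h2⟩, h3⟩
      refine ⟨fun m hm hmZ => h1 m ⟨hm, hmZ⟩, fun m hm b hb hmb => ?_,
        fun h hh => (h3 h).resolve_left hh⟩
      by_contra hb1
      exact h2 m b ⟨hb, hb1⟩ ⟨hm, hmb⟩
  have hc := isClopen_eval_true hf
  rw [key]
  refine (IsClosed.inter ?_ ?_).inter ?_
  · exact isClosed_iInter fun m => ((hc m).inter (hZ m)).compl.isClosed
  · exact isClosed_iInter fun m => isClosed_iInter fun b => isClosed_iInter fun _ =>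
      ((hc m).inter (hc _)).compl.isClosed
  · exact isClosed_iInter fun h =>
      ((hZ h).union (isClopen_exists_mem hB fun b => hc (h * b))).isClosed

theorem isClosed_tilings {L B T C C' : Set G} (hL : L.Finite) (hB : B.Finite) (hT : T.Finite)
    (hC : C.Finite) (hC' : C'.Finite) : IsClosed (tilings L B T C C') := by
  have h1 : Continuous fun p : (G → Bool) × (G → Bool) × (G → Bool) => p.1 := continuous_fst
  have h2 : Continuous fun p : (G → Bool) × (G → Bool) × (G → Bool) => p.2.1 := by fun_prop
  have h3 : Continuous fun p : (G → Bool) × (G → Bool) × (G → Bool) => p.2.2 := by fun_prop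
  have key : IsClosed {p : (G → Bool) × (G → Bool) × (G → Bool) |
      IsTiling L B T C C' (trueSet p.1) (trueSet p.2.1) (trueSet p.2.2)} := by
    have : {p : (G → Bool) × (G → Bool) × (G → Bool) |
        IsTiling L B T C C' (trueSet p.1) (trueSet p.2.1) (trueSet p.2.2)} =
        {p | IsSaturated L ∅ (trueSet p.2.2)} ∩
        {p | IsSaturated B {h | ∃ t ∈ T, h * t ∈ trueSet p.2.2} (trueSet p.2.1)} ∩
        ⋂ g, {p | g ∈ trueSet p.1 ↔
          (∃ c ∈ C, g * c⁻¹ ∈ trueSet p.2.1) ∨ ∃ c ∈ C', g * c⁻¹ ∈ trueSet p.2.2} := by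
      ext p
      simp only [mem_inter_iff, mem_iInter, mem_ofPred_eq]
      exact ⟨fun h => ⟨⟨h.1, h.2⟩, h.3⟩, fun h => ⟨h.1.1, h.1.2, h.2⟩⟩
    rw [this]
    refine (IsClosed.inter ?_ ?_).inter (isClosed_iInter fun g => ?_)
    · exact isClosed_isSaturated hL h3 fun h => by simpa using isClopen_empty
    · exact isClosed_isSaturated hB h2 fun h =>
        isClopen_exists_mem hT fun t => isClopen_eval_true h3 (h * t)
    · have hl := isClopen_eval_true h1 g
      have hr := (isClopen_exists_mem hC fun c => isClopen_eval_true h2 (g * c⁻¹)).union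
        (isClopen_exists_mem hC' fun c => isClopen_eval_true h3 (g * c⁻¹))
      convert ((hl.inter hr).union (hl.compl.inter hr.compl)).isClosed using 1
      ext p
      simp only [mem_ofPred_eq, mem_union, mem_inter_iff, mem_compl_iff]
      exact iff_iff_and_or_not_and_not
  convert (key.isCompact.image h1).isClosed using 1
  ext x
  simp [tilings]

theorem isStronglyIrreducible_tilings {L B T C C' : Set G} (hL : L.Finite) (hB : B.Finite)
    (hT : T.Finite) (hC : C.Finite) (hC' : C'.Finite) (hL1 : 1 ∈ L) (hLinv : L⁻¹ = L)
    (hB1 : 1 ∈ B) (hBinv : B⁻¹ = B) : IsStronglyIrreducible (tilings L B T C C') where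
  isClosed := isClosed_tilings hL hB hT hC hC'
  translate_mem := by
    rintro g x ⟨y, z, h⟩
    refine ⟨fun k => y (g * k), fun k => z (g * k), h.snd.translate g, ?_, fun k => ?_⟩
    · simpa [trueSet, mul_assoc] using h.fst.translate g
    · simpa [trueSet, mul_assoc] using h.mem_iff (g * k)
  exists_glue := by
    refine ⟨(C'⁻¹ ∪ C⁻¹ * B * T) * (L * L * L⁻¹) * (C'⁻¹ ∪ C⁻¹ * B * T)⁻¹ ∪
      C⁻¹ * (B * B * B⁻¹) * C⁻¹⁻¹, ?_, fun ι E x hx hE => ?_⟩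
    · have h2 : (C'⁻¹ ∪ C⁻¹ * B * T).Finite := hC'.inv.union ((hC.inv.mul hB).mul hT)
      exact ((h2.mul ((hL.mul hL).mul hL.inv)).mul h2.inv).union
        ((hC.inv.mul ((hB.mul hB).mul hB.inv)).mul hC.inv.inv)
    choose y z h using hx
    obtain ⟨M₂, hM₂, hM₂E⟩ := exists_isSaturated_glue (Z := ∅) hL1 hLinv
      (hE.mono subset_union_left).mul (fun i => (h i).snd) (fun _ _ _ => Iff.rfl)
    obtain ⟨M₁, hM₁, hM₁E⟩ := exists_isSaturated_glue (Z := {h | ∃ t ∈ T, h * t ∈ M₂}) hB1 hBinv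
      (hE.mono subset_union_right).mul (fun i => (h i).fst) (by
        rintro i _ ⟨_, ⟨e, he, c, hc, rfl⟩, b, hb, rfl⟩
        refine exists_congr fun t => and_congr_right fun ht => hM₂E i _ ?_
        exact ⟨e, he, c * b * t, Or.inr (Set.mul_mem_mul (Set.mul_mem_mul hc hb) ht),
          by simp [mul_assoc]⟩)
    let V : Set G := {g | (∃ c ∈ C, g * c⁻¹ ∈ M₁) ∨ ∃ c ∈ C', g * c⁻¹ ∈ M₂}
    refine ⟨V.boolIndicator, ⟨M₁.boolIndicator, M₂.boolIndicator, ?_⟩, fun i e he => ?_⟩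
    · simp only [trueSet_boolIndicator]
      exact ⟨hM₂, hM₁, fun g => Iff.rfl⟩
    · rw [Bool.eq_iff_iff, ← Set.mem_iff_boolIndicator]
      refine Iff.trans ?_ ((h i).mem_iff e).symm
      refine or_congr ?_ ?_
      · exact exists_congr fun c => and_congr_right fun hc =>
          hM₁E i _ (Set.mul_mem_mul he (Set.inv_mem_inv.2 hc))
      · exact exists_congr fun c => and_congr_right fun hc =>
          hM₂E i _ (Set.mul_mem_mul he (Or.inl (Set.inv_mem_inv.2 hc)))

end StronglyIrreducible

section Proximal

variable {G : Type} [Group G]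

/-- Every finite subset of `G` is moved off itself, apart from the identity, by conjugation by some
element on which the character `χ` is large. -/
def HasSpreadingConjugators (χ : G → ℝ) : Prop :=
  ∀ U : Set G, U.Finite → ∃ d, (∀ u ∈ U, 10 * |χ u| < χ d) ∧ ∀ u ∈ U, d * u * d⁻¹ ∈ U → u = 1

theorem exists_isStronglyIrreducible_sep {χ : G → ℝ} (hχ : ∀ g h, χ (g * h) = χ g + χ h)
    (hd : HasSpreadingConjugators χ) {Q : Set G} (hQ : Q.Finite) (hQ1 : 1 ∈ Q) (hQinv : Q⁻¹ = Q) :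
    ∃ S : Set (G → Bool), IsStronglyIrreducible S ∧
      (∀ x ∈ S, ∀ v ∈ trueSet x, ∀ v' ∈ trueSet x, v⁻¹ * v' ∈ Q → v = v') ∧
      ∀ x ∈ S, ∀ y ∈ S, (trueSet x ∩ trueSet y).Nonempty := by
  have χone : χ 1 = 0 := by simpa using hχ 1 1
  have χinv : ∀ g, χ g⁻¹ = -χ g := fun g => by
    have := hχ g g⁻¹
    rw [mul_inv_cancel, χone] at this
    linarith
  have memQinv : ∀ q ∈ Q, q⁻¹ ∈ Q := fun q hq => by rw [← hQinv]; simpa using hq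
  obtain ⟨c, hcχ, hc⟩ := hd (Q * Q) (hQ.mul hQ)
  have hcQ : ∀ q ∈ Q, 10 * |χ q| < χ c := fun q hq => hcχ q ⟨q, hq, 1, hQ1, mul_one q⟩
  have hc0 : 0 < χ c := by simpa [χone] using hcQ 1 hQ1
  set C : Set G := {1, c} with hC
  have hCfin : C.Finite := by simp [hC]
  set Y : Set G := C * Q * {c, c⁻¹} with hY
  have hYfin : Y.Finite := (hCfin.mul hQ).mul (by simp)
  set B : Set G := C * Q * C⁻¹ with hB
  have hBfin : B.Finite := (hCfin.mul hQ).mul hCfin.inv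
  have hBinv : B⁻¹ = B := by simp [hB, hQinv, mul_assoc]
  have hB1 : 1 ∈ B := ⟨1, ⟨1, by simp [hC], 1, hQ1, mul_one 1⟩, 1, by simp [hC], mul_one 1⟩
  have hCsep : ∀ y ∈ C, ∀ y' ∈ C, y⁻¹ * y' ∈ Q → y = y' := by
    intro y hy y' hy' hq
    have h1 := hcQ _ hq
    rw [hχ, χinv] at h1
    obtain ⟨h1l, h1r⟩ := abs_lt.1 (by linarith : |-χ y + χ y'| < χ c / 10)
    rcases hy with rfl | rfl <;> rcases hy' with rfl | rfl <;> first | rfl | skip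
    all_goals
      exfalso
      simp only [χone] at h1l h1r
      linarith
  have hYsep : ∀ y ∈ Y, ∀ y' ∈ Y, y⁻¹ * y' ∈ Q → y = y' := by
    have key : ∀ p ∈ C, ∀ q ∈ Q, ∀ e ∈ ({c, c⁻¹} : Set G), ∀ p' ∈ C, ∀ q' ∈ Q,
        ∀ e' ∈ ({c, c⁻¹} : Set G), (p * q * e)⁻¹ * (p' * q' * e') ∈ Q → p = p' ∧ e = e' := by
      intro p hp q hq e he p' hp' q' hq' e' he' h
      have h1 := hcQ _ h
      have h2 := hcQ _ hq
      have h3 := hcQ _ hq'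
      simp only [hχ, χinv] at h1
      obtain ⟨h2l, h2r⟩ := abs_lt.1 (by linarith : |χ q| < χ c / 10)
      obtain ⟨h3l, h3r⟩ := abs_lt.1 (by linarith : |χ q'| < χ c / 10)
      obtain ⟨h1l, h1r⟩ := abs_lt.1
        (by linarith : |-(χ p + χ q + χ e) + (χ p' + χ q' + χ e')| < χ c / 10)
      rcases hp with rfl | rfl <;> rcases hp' with rfl | rfl <;> rcases he with rfl | rfl <;>
        rcases he' with rfl | rfl <;> first | exact ⟨rfl, rfl⟩ | skip
      all_goals
        exfalso
        simp only [χone, χinv] at h1l h1r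
        linarith
    rintro _ ⟨_, ⟨p, hp, q, hq, rfl⟩, e, he, rfl⟩ _ ⟨_, ⟨p', hp', q', hq', rfl⟩, e', he', rfl⟩ h
    obtain ⟨rfl, rfl⟩ := key p hp q hq e he p' hp' q' hq' e' he' h
    have h' : e⁻¹ * (q⁻¹ * q') * e ∈ Q * Q := by
      refine ⟨_, h, 1, hQ1, ?_⟩
      simp only
      group
    have hqq : q⁻¹ * q' ∈ Q * Q := ⟨q⁻¹, memQinv q hq, q', hq', rfl⟩
    have h1 : q⁻¹ * q' = 1 := by
      rcases he with rfl | rfl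
      · have := hc _ h' (by convert hqq using 1; group)
        have h2 := congrArg (fun t => e * t * e⁻¹) this
        simpa [mul_assoc] using h2
      · exact hc _ hqq (by simpa using h')
    rw [inv_mul_eq_one.1 h1]
  have hBY : ∀ b ∈ B, ∃ k ∈ C, b * k ∈ Y := by
    rintro _ ⟨_, ⟨p, hp, q, hq, rfl⟩, k, hk, rfl⟩
    have hpq := Set.mul_mem_mul hp hq
    rcases hk with hk | hk
    · refine ⟨c, by simp [hC], ⟨p * q, hpq, c, by simp, ?_⟩⟩
      simp [inv_eq_one.1 hk]
    · refine ⟨1, by simp [hC], ⟨p * q, hpq, k, ?_, by simp⟩⟩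
      rw [← hk]
      simp
  set U₀ : Set G := C * Q * Y⁻¹ with hU₀
  have hU₀fin : U₀.Finite := (hCfin.mul hQ).mul hYfin.inv
  obtain ⟨r, hrχ, hr⟩ := hd (U₀ ∪ Y ∪ Q) ((hU₀fin.union hYfin).union hQ)
  have hrU : ∀ u ∈ U₀, 10 * |χ u| < χ r := fun u hu => hrχ u (Or.inl (Or.inl hu))
  have hrY : ∀ u ∈ Y, 10 * |χ u| < χ r := fun u hu => hrχ u (Or.inl (Or.inr hu))
  have hrQ : ∀ u ∈ Q, 10 * |χ u| < χ r := fun u hu => hrχ u (Or.inr hu)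
  set C' : Set G := ({1, r} : Set G) * Y with hC'
  have hC'fin : C'.Finite := Set.Finite.mul (by simp) hYfin
  have hC'sep : ∀ y ∈ C', ∀ y' ∈ C', y⁻¹ * y' ∈ Q → y = y' := by
    rintro _ ⟨k, hk, y, hy, rfl⟩ _ ⟨k', hk', y', hy', rfl⟩ h
    have h1 := hrQ _ h
    have h2 := hrY _ hy
    have h3 := hrY _ hy'
    simp only [hχ, χinv] at h1
    obtain ⟨h1l, h1r⟩ := abs_lt.1 (by linarith : |-(χ k + χ y) + (χ k' + χ y')| < χ r / 10)
    obtain ⟨h2l, h2r⟩ := abs_lt.1 (by linarith : |χ y| < χ r / 10)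
    obtain ⟨h3l, h3r⟩ := abs_lt.1 (by linarith : |χ y'| < χ r / 10)
    have hkk : k = k' := by
      rcases hk with rfl | rfl <;> rcases hk' with rfl | rfl <;> first | rfl | skip
      all_goals
        exfalso
        simp only [χone] at h1l h1r
        linarith
    subst hkk
    rw [hYsep y hy y' hy' (by simpa [mul_assoc] using h)]
  set T : Set G := C * Q * C'⁻¹ with hT
  have hTfin : T.Finite := (hCfin.mul hQ).mul hC'fin.inv
  have hTU : ∀ t ∈ T, ∃ u ∈ U₀, t = u ∨ t = u * r⁻¹ := by
    rintro _ ⟨s, hs, k, hk, rfl⟩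
    obtain ⟨k', hk', y, hy, hky⟩ := hk
    obtain rfl : k = y⁻¹ * k'⁻¹ := by
      have h2 : k' * y = k⁻¹ := hky
      rw [← inv_inv k, ← h2, mul_inv_rev]
    refine ⟨s * y⁻¹, Set.mul_mem_mul hs (Set.inv_mem_inv.2 hy), ?_⟩
    rcases hk' with rfl | rfl
    · left; simp
    · right; simp [mul_assoc]
  set A : Set G := C' * Q * C'⁻¹ ∪ T⁻¹ * {r⁻¹} * T with hA
  have hAfin : A.Finite := ((hC'fin.mul hQ).mul hC'fin.inv).union
    ((hTfin.inv.mul (by simp)).mul hTfin)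
  set L : Set G := {1} ∪ A ∪ A⁻¹ with hL
  have hLfin : L.Finite := ((by simp : ({1} : Set G).Finite).union hAfin).union hAfin.inv
  have hL1 : 1 ∈ L := Or.inl (Or.inl rfl)
  have hLinv : L⁻¹ = L := by
    simp only [hL, Set.union_inv, inv_inv, Set.inv_singleton, inv_one]
    rw [union_assoc, union_comm A⁻¹, ← union_assoc]
  have hAL : A ⊆ L := fun x hx => Or.inl (Or.inr hx)
  refine ⟨tilings L B T C C', isStronglyIrreducible_tilings hLfin hBfin hTfin hCfin hC'fin hL1 hLinv
    hB1 hBinv, ?_, ?_⟩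
  · rintro x ⟨y, z, h⟩ v hv v' hv' hq
    have cross : ∀ v v' : G, v⁻¹ * v' ∈ Q → (∃ k ∈ C, v * k⁻¹ ∈ trueSet y) →
        (∃ k ∈ C', v' * k⁻¹ ∈ trueSet z) → False := by
      rintro v v' hq ⟨k, hk, hkm⟩ ⟨k', hk', hkm'⟩
      refine h.fst.notMem _ hkm ⟨k * (v⁻¹ * v') * k'⁻¹,
        Set.mul_mem_mul (Set.mul_mem_mul hk hq) (Set.inv_mem_inv.2 hk'), ?_⟩
      simpa [mul_assoc] using hkm'
    have same : ∀ (K D M Z : Set G), IsSaturated D Z M → K * Q * K⁻¹ ⊆ D →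
        (∀ y ∈ K, ∀ y' ∈ K, y⁻¹ * y' ∈ Q → y = y') → (∃ k ∈ K, v * k⁻¹ ∈ M) →
        (∃ k ∈ K, v' * k⁻¹ ∈ M) → v = v' := by
      rintro K D M Z hM hKD hKsep ⟨k, hk, hkm⟩ ⟨k', hk', hkm'⟩
      have h1 : k * (v⁻¹ * v') * k'⁻¹ = 1 := hM.sep _ hkm _
        (hKD (Set.mul_mem_mul (Set.mul_mem_mul hk hq) (Set.inv_mem_inv.2 hk')))
        (by simpa [mul_assoc] using hkm')
      have h2 : v⁻¹ * v' = k⁻¹ * k' := by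
        rw [mul_inv_eq_one] at h1
        rw [← h1]
        simp
      have h3 : k = k' := hKsep k hk k' hk' (h2 ▸ hq)
      rw [h3, inv_mul_cancel] at h2
      exact inv_mul_eq_one.1 h2
    rcases (h.mem_iff v).1 hv with h1 | h1 <;> rcases (h.mem_iff v').1 hv' with h2 | h2
    · exact same C B _ _ h.fst subset_rfl hCsep h1 h2
    · exact (cross v v' hq h1 h2).elim
    · exact (cross v' v (by simpa using memQinv _ hq) h2 h1).elim
    · exact same C' L _ _ h.snd (fun x hx => hAL (Or.inl hx)) hC'sep h1 h2
  · rintro x ⟨y, z, h⟩ x' ⟨y', z', h'⟩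
    obtain ⟨m, -, hm⟩ := h.snd.sat 1 (by simp)
    rw [one_mul] at hm
    have hx : ∀ k ∈ C', m * k ∈ trueSet x := fun k hk =>
      (h.mem_iff _).2 (Or.inr ⟨k, hk, by simpa using hm⟩)
    have hfst : ∀ k ∈ ({1, r} : Set G), (∃ b ∈ B, m * k * b ∈ trueSet y') →
        (trueSet x ∩ trueSet x').Nonempty := by
      rintro k hk ⟨b, hb, hmb⟩
      obtain ⟨s, hs, hbs⟩ := hBY b hb
      refine ⟨m * (k * (b * s)), hx _ (Set.mul_mem_mul hk hbs), (h'.mem_iff _).2 (Or.inl ⟨s, hs, ?_⟩)⟩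
      simpa [mul_assoc] using hmb
    by_cases h1 : ∃ b ∈ B, m * 1 * b ∈ trueSet y'
    · exact hfst 1 (by simp) h1
    by_cases h2 : ∃ b ∈ B, m * r * b ∈ trueSet y'
    · exact hfst r (by simp) h2
    obtain ⟨t, ht, hmt⟩ : ∃ t ∈ T, m * t ∈ trueSet z' := by
      by_contra hcon
      exact h1 (h'.fst.sat (m * 1) (by simpa using hcon))
    obtain ⟨s, hs, hms⟩ : ∃ t ∈ T, m * r * t ∈ trueSet z' := by
      by_contra hcon
      exact h2 (h'.fst.sat (m * r) hcon)
    have hst : s⁻¹ * r⁻¹ * t = 1 := by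
      refine h'.snd.sep _ hms _ (hAL (Or.inr ?_)) ?_
      · exact Set.mul_mem_mul (Set.mul_mem_mul (Set.inv_mem_inv.2 hs) rfl) ht
      · simpa [mul_assoc] using hmt
    have hst' : t = r * s := by
      rw [← mul_inv_rev, inv_mul_eq_one] at hst
      exact hst.symm
    obtain ⟨u, hu, htu⟩ := hTU t ht
    obtain ⟨w, hw, hsw⟩ := hTU s hs
    obtain ⟨hul, hur⟩ := abs_lt.1 (by linarith [hrU u hu] : |χ u| < χ r / 10)
    obtain ⟨hwl, hwr⟩ := abs_lt.1 (by linarith [hrU w hw] : |χ w| < χ r / 10)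
    have ht1 : t = 1 := by
      have hχst := congrArg χ hst'
      rcases htu with rfl | rfl <;> rcases hsw with rfl | rfl <;>
        simp only [hχ, χinv] at hχst
      · linarith
      · have hw1 := hr w (Or.inl (Or.inl hw)) (by rw [mul_assoc, ← hst']; exact Or.inl (Or.inl hu))
        rw [hst', hw1]
        simp
      · linarith
      · linarith
    rw [ht1, mul_one] at hmt
    obtain ⟨k, hk, hbk⟩ := hBY 1 hB1
    have hkC' : 1 * (1 * k) ∈ C' := Set.mul_mem_mul (by simp) hbk
    exact ⟨m * (1 * (1 * k)), hx _ hkC',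
      (h'.mem_iff _).2 (Or.inr ⟨_, hkC', by simpa using hmt⟩)⟩

theorem IsStronglyIrreducible.exists_subset_agree {χ : G → ℝ}
    (hχ : ∀ g h, χ (g * h) = χ g + χ h) (hd : HasSpreadingConjugators χ) {S : Set (G → Bool)}
    (hS : IsStronglyIrreducible S) {W : Set G} (hW : W.Finite) :
    ∃ S' ⊆ S, IsStronglyIrreducible S' ∧
      ∀ x ∈ S', ∀ y ∈ S', ∃ g, ∀ w ∈ W, x (g * w) = y (g * w) := by
  obtain ⟨x₀, hx₀⟩ := hS.nonempty
  obtain ⟨D, hD, hglue⟩ := hS.exists_glue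
  set Q₀ : Set G := W * D * W⁻¹ with hQ₀
  have hQ₀fin : Q₀.Finite := (hW.mul hD).mul hW.inv
  set Q : Set G := {1} ∪ Q₀ ∪ Q₀⁻¹ with hQ
  obtain ⟨𝒱, h𝒱, hsep, hinter⟩ := exists_isStronglyIrreducible_sep hχ hd (Q := Q)
    (((by simp : ({1} : Set G).Finite).union hQ₀fin).union hQ₀fin.inv) (Or.inl (Or.inl rfl)) (by
      simp only [hQ, Set.union_inv, inv_inv, Set.inv_singleton, inv_one]
      rw [union_assoc, union_comm Q₀⁻¹, ← union_assoc])
  refine ⟨{x | x ∈ S ∧ ∃ y ∈ 𝒱, ∀ v ∈ trueSet y, ∀ w ∈ W, x (v * w) = x₀ w}, fun x hx => hx.1,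
    ⟨?_, ?_, ?_⟩, ?_⟩
  · have hcl : IsClosed {p : (G → Bool) × (G → Bool) | (p.1 ∈ S ∧ p.2 ∈ 𝒱) ∧
        ∀ v w, w ∈ W → v ∈ trueSet p.2 → p.1 (v * w) = x₀ w} := by
      refine ((hS.isClosed.preimage continuous_fst).inter
        (h𝒱.isClosed.preimage continuous_snd)).inter ?_
      have : {p : (G → Bool) × (G → Bool) | ∀ v w, w ∈ W → v ∈ trueSet p.2 → p.1 (v * w) = x₀ w} =
          ⋂ v, ⋂ w, ⋂ (_ : w ∈ W), {p | v ∈ trueSet p.2 → p.1 (v * w) = x₀ w} := by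
        ext
        simp
      change IsClosed {p : (G → Bool) × (G → Bool) | ∀ v w, w ∈ W → v ∈ trueSet p.2 →
        p.1 (v * w) = x₀ w}
      rw [this]
      refine isClosed_iInter fun v => isClosed_iInter fun w => isClosed_iInter fun _ => ?_
      refine isClosed_imp (isClopen_eval_true continuous_snd v).isOpen ?_
      exact isClosed_eq (by fun_prop) continuous_const
    convert (hcl.isCompact.image continuous_fst).isClosed using 1
    ext x
    constructor
    · rintro ⟨hx, y, hy, h⟩
      exact ⟨(x, y), ⟨⟨hx, hy⟩, fun v w hw hv => h v hv w hw⟩, rfl⟩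
    · rintro ⟨⟨x, y⟩, ⟨⟨hx, hy⟩, h⟩, rfl⟩
      exact ⟨hx, y, hy, fun v hv w hw => h v w hw hv⟩
  · rintro g x ⟨hx, y, hy, h⟩
    refine ⟨hS.translate_mem g x hx, _, h𝒱.translate_mem g y hy, fun v hv w hw => ?_⟩
    simpa [mul_assoc] using h (g * v) hv w hw
  · obtain ⟨D', hD', hglue'⟩ := h𝒱.exists_glue
    set T : Set G := (D ∪ D⁻¹) * W⁻¹ with hT
    have hTfin : T.Finite := (hD.union hD.inv).mul hW.inv
    set A : Set G := {1} ∪ T * W with hA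
    have hAfin : A.Finite := (by simp : ({1} : Set G).Finite).union (hTfin.mul hW)
    refine ⟨T * D' * T⁻¹ ∪ A * D * A⁻¹, ((hTfin.mul hD').mul hTfin.inv).union
      ((hAfin.mul hD).mul hAfin.inv), fun ι E x hx hE => ?_⟩
    choose hxS y hy hxy using hx
    obtain ⟨V, hV, hVE⟩ := hglue' ι _ y hy (hE.mono subset_union_left).mul
    have hEA := (hE.mono subset_union_right).mul
    let J := {v : G // v ∈ trueSet V ∧ ∀ i, v ∉ E i * T}
    obtain ⟨z, hz, hzE⟩ := hglue (ι ⊕ J)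
      (Sum.elim (fun i => E i ∪ (trueSet V ∩ (E i * T)) * W) (fun v => v.1 • W))
      (Sum.elim x (fun v h => x₀ (v.1⁻¹ * h)))
      (by
        rintro (i | v)
        · exact hxS i
        · exact hS.translate_mem _ _ hx₀)
      (by
        have hsub : ∀ i, E i ∪ (trueSet V ∩ (E i * T)) * W ⊆ E i * A := by
          rintro i _ (he | ⟨v, ⟨-, e, he, t, ht, rfl⟩, w, hw, rfl⟩)
          · exact ⟨_, he, 1, Or.inl rfl, mul_one _⟩
          · exact ⟨e, he, t * w, Or.inr (Set.mul_mem_mul ht hw), by simp [mul_assoc]⟩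
        have hVW : ∀ v ∈ trueSet V, ∀ v' ∈ trueSet V, v ≠ v' → ∀ w ∈ W, ∀ w' ∈ W,
            (v * w)⁻¹ * (v' * w') ∉ D := by
          intro v hv v' hv' hne w hw w' hw' hmem
          refine hne (hsep V hV v hv v' hv' (Or.inl (Or.inr ?_)))
          convert Set.mul_mem_mul (Set.mul_mem_mul hw hmem) (Set.inv_mem_inv.2 hw') using 1
          group
        rintro (i | v) (j | v') hne e he e' he' hmem
        · exact hEA i j (by simpa using hne) e (hsub i he) e' (hsub j he') hmem
        · obtain ⟨w', hw', rfl⟩ := he'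
          rcases he with he | ⟨v, ⟨hv, hvE⟩, w, hw, rfl⟩
          · refine v'.2.2 i ⟨e, he, _, Set.mul_mem_mul (Or.inl hmem) (Set.inv_mem_inv.2 hw'), ?_⟩
            simp [mul_assoc]
          · exact hVW v hv v' v'.2.1 (fun h => v'.2.2 i (h ▸ hvE)) w hw w' hw' hmem
        · obtain ⟨w, hw, rfl⟩ := he
          rcases he' with he | ⟨v', ⟨hv, hvE⟩, w', hw', rfl⟩
          · refine v.2.2 j ⟨e', he, _, Set.mul_mem_mul (Or.inr (Set.inv_mem_inv.2 hmem))
              (Set.inv_mem_inv.2 hw), ?_⟩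
            simp [mul_assoc]
          · exact hVW v v.2.1 v' hv (fun h => v.2.2 j (h ▸ hvE)) w hw w' hw' hmem
        · obtain ⟨w, hw, rfl⟩ := he
          obtain ⟨w', hw', rfl⟩ := he'
          exact hVW v v.2.1 v' v'.2.1 (fun h => hne (by rw [Subtype.ext h])) w hw w' hw' hmem)
    refine ⟨z, ⟨hz, V, hV, fun v hv w hw => ?_⟩, fun i e he => hzE (Sum.inl i) e (Or.inl he)⟩
    by_cases hvE : ∃ i, v ∈ E i * T
    · obtain ⟨i, hi⟩ := hvE
      have h1 := hzE (Sum.inl i) (v * w) (Or.inr ⟨v, ⟨hv, hi⟩, w, hw, rfl⟩)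
      exact h1.trans (hxy i v ((hVE i v hi).symm.trans hv) w hw)
    · push Not at hvE
      have h1 := hzE (Sum.inr ⟨v, hv, hvE⟩) (v * w) ⟨w, hw, rfl⟩
      simpa using h1
  · rintro x ⟨-, y, hy, hxy⟩ x' ⟨-, y', hy', hxy'⟩
    obtain ⟨g, hg, hg'⟩ := hinter y hy y' hy'
    exact ⟨g, fun w hw => (hxy g hg w hw).trans (hxy' g hg' w hw).symm⟩

theorem exists_proximal_subshift [Countable G] [Nontrivial G] {χ : G → ℝ}
    (hχ : ∀ g h, χ (g * h) = χ g + χ h) (hd : HasSpreadingConjugators χ) :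
    ∃ X : Set (G → Bool), X.Nonempty ∧ IsClosed X ∧
      (∀ g, ∀ x ∈ X, (fun h => x (g * h)) ∈ X) ∧
      (∀ x ∈ X, ∀ y ∈ X, ∀ W : Finset G, ∃ g, ∀ w ∈ W, x (g * w) = y (g * w)) ∧
      ∀ x ∈ X, ∃ g h, x (g * h) ≠ x h := by
  obtain ⟨k, hk⟩ := exists_ne (1 : G)
  obtain ⟨S₀, hS₀, hsep, hinter⟩ := exists_isStronglyIrreducible_sep hχ hd (Q := {1, k, k⁻¹})
    (by simp) (by simp) (by ext; simp [or_comm])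
  choose next hsub hnext hagree using fun (S : {S : Set (G → Bool) // IsStronglyIrreducible S})
    (W : Finset G) => S.2.exists_subset_agree hχ hd W.finite_toSet
  obtain ⟨W, hW⟩ := exists_surjective_nat (Finset G)
  let S : ℕ → {S : Set (G → Bool) // IsStronglyIrreducible S} := fun n =>
    Nat.rec ⟨S₀, hS₀⟩ (fun n S => ⟨next S (W n), hnext S (W n)⟩) n
  refine ⟨⋂ n, (S n).1, ?_, ?_, ?_, ?_, ?_⟩
  · exact IsCompact.nonempty_iInter_of_sequence_nonempty_isCompact_isClosed (fun n => (S n).1)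
      (fun n => hsub (S n) (W n)) (fun n => (S n).2.nonempty) (S 0).2.isClosed.isCompact
      (fun n => (S n).2.isClosed)
  · exact isClosed_iInter fun n => (S n).2.isClosed
  · intro g x hx
    exact mem_iInter.2 fun n => (S n).2.translate_mem g x (mem_iInter.1 hx n)
  · intro x hx y hy V
    obtain ⟨n, rfl⟩ := hW V
    exact hagree (S n) (W n) x (mem_iInter.1 hx (n + 1)) y (mem_iInter.1 hy (n + 1))
  · intro x hx
    by_contra! hcon
    have hx0 : x ∈ S₀ := mem_iInter.1 hx 0
    obtain ⟨v, hv, -⟩ := hinter x hx0 x hx0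
    have htrue : ∀ g, g ∈ trueSet x := fun g => by
      have := hcon (g * v⁻¹) v
      rw [inv_mul_cancel_right] at this
      exact this.trans hv
    exact hk (hsep x hx0 1 (htrue 1) k (htrue k) (by simp)).symm

end Proximal

section Thompson

open Filter

theorem exists_eventually_eq_add {g : Equiv.Perm ℝ} (hg : g ∈ F) :
    ∃ t : ℝ, ∀ᶠ x in atBot, g x = x + t := by
  have hshift (s : ℝ) : Tendsto (fun x : ℝ => x + s) atBot atBot :=
    tendsto_atBot_add_const_right _ s tendsto_id
  induction hg using Subgroup.closure_induction with
  | mem g hg =>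
    rcases hg with rfl | rfl
    · exact ⟨-1, Eventually.of_forall fun x => sub_eq_add_neg x 1⟩
    · refine ⟨0, (eventually_le_atBot 0).mono fun x hx => ?_⟩
      simp [b, hx]
  | one => exact ⟨0, by simp⟩
  | mul g h _ _ hg hh =>
    obtain ⟨s, hs⟩ := hg
    obtain ⟨t, ht⟩ := hh
    refine ⟨t + s, ?_⟩
    filter_upwards [ht, (hshift t).eventually hs] with x hx hx'
    rw [Equiv.Perm.mul_apply, hx, hx', add_assoc]
  | inv g _ hg =>
    obtain ⟨t, ht⟩ := hg
    refine ⟨-t, ?_⟩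
    filter_upwards [(hshift (-t)).eventually ht] with x hx
    rw [Equiv.Perm.inv_eq_iff_eq, hx, neg_add_cancel_right]

/-- The element `g` of Thompson's group is the translation by `shift g` near `-∞`. -/
def shift (g : F) : ℝ := (exists_eventually_eq_add g.2).choose

theorem eventually_eq_add_shift (g : F) : ∀ᶠ x in atBot, g.1 x = x + shift g :=
  (exists_eventually_eq_add g.2).choose_spec

theorem shift_eq {g : F} {t : ℝ} (h : ∀ᶠ x in atBot, g.1 x = x + t) : shift g = t := by
  obtain ⟨x, hx, hx'⟩ := ((eventually_eq_add_shift g).and h).exists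
  linarith

theorem shift_mul (g h : F) : shift (g * h) = shift g + shift h := by
  refine shift_eq ?_
  have hshift : Tendsto (fun x : ℝ => x + shift h) atBot atBot :=
    tendsto_atBot_add_const_right _ _ tendsto_id
  filter_upwards [eventually_eq_add_shift h, hshift.eventually (eventually_eq_add_shift g)]
    with x hx hx'
  rw [Subgroup.coe_mul, Equiv.Perm.mul_apply, hx, hx']
  ring

theorem shift_one : shift 1 = 0 := by simpa using shift_mul 1 1

theorem shift_conj (g h : F) : shift (g * h * g⁻¹) = shift h := by
  have := shift_mul g g⁻¹
  rw [mul_inv_cancel, shift_one] at this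
  rw [shift_mul, shift_mul]
  linarith

theorem shift_pow (g : F) (n : ℕ) : shift (g ^ n) = n * shift g := by
  induction n with
  | zero => simpa using shift_one
  | succ n ih =>
    rw [pow_succ, shift_mul, ih]
    push_cast
    ring

/-- The translation by `1`, as an element of Thompson's group. -/
def addOne : F := ⟨a⁻¹, F.inv_mem (Subgroup.subset_closure (by simp))⟩

/-- The generator `b`, as an element of Thompson's group. -/
def halve : F := ⟨b, Subgroup.subset_closure (by simp)⟩

theorem addOne_apply (x : ℝ) : addOne.1 x = x + 1 := rfl

theorem addOne_pow_apply (n : ℕ) (x : ℝ) : (addOne ^ n).1 x = x + n := by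
  induction n generalizing x with
  | zero => simp
  | succ n ih =>
    rw [pow_succ, Subgroup.coe_mul, Equiv.Perm.mul_apply, addOne_apply, ih]
    push_cast
    ring

theorem shift_addOne : shift addOne = 1 := shift_eq (Eventually.of_forall addOne_apply)

theorem halve_apply_of_nonpos {x : ℝ} (hx : x ≤ 0) : halve.1 x = x := by simp [halve, b, hx]

theorem shift_halve : shift halve = 0 :=
  shift_eq ((eventually_le_atBot 0).mono fun x hx => by simpa using halve_apply_of_nonpos hx)

theorem halve_apply_pos_lt {x : ℝ} (hx : 0 < x) : 0 < halve.1 x ∧ halve.1 x < x := by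
  simp only [halve, b, Equiv.coe_fn_mk]
  split_ifs <;> constructor <;> linarith

theorem halve_pow_apply_zero (n : ℕ) : (halve ^ n).1 0 = 0 := by
  induction n with
  | zero => simp
  | succ n ih =>
    rw [pow_succ, Subgroup.coe_mul, Equiv.Perm.mul_apply, halve_apply_of_nonpos le_rfl, ih]

theorem halve_pow_apply_lt {n : ℕ} (hn : n ≠ 0) {x : ℝ} (hx : 0 < x) : (halve ^ n).1 x < x := by
  suffices ∀ n : ℕ, 0 < (halve ^ (n + 1)).1 x ∧ (halve ^ (n + 1)).1 x < x by
    obtain ⟨n, rfl⟩ := Nat.exists_eq_succ_of_ne_zero hn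
    exact (this n).2
  intro n
  induction n with
  | zero => simpa using halve_apply_pos_lt hx
  | succ n ih =>
    rw [pow_succ', Subgroup.coe_mul, Equiv.Perm.mul_apply]
    exact ⟨(halve_apply_pos_lt ih.1).1, (halve_apply_pos_lt ih.1).2.trans ih.2⟩

/-- The elements of Thompson's group that are translations of the line. -/
def IsTranslation (g : F) : Prop := ∀ x, g.1 x = x + shift g

theorem IsTranslation.ext {g h : F} (hg : IsTranslation g) (hh : IsTranslation h)
    (hgh : shift g = shift h) : g = h :=
  Subtype.ext (Equiv.ext fun x => by rw [hg, hh, hgh])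

theorem isTranslation_of_commute {n : ℕ} (hn : n ≠ 0) {g : F} (h : Commute (addOne ^ n) g) :
    IsTranslation g := by
  intro x
  have hstep (y : ℝ) : g.1 (y + n) = g.1 y + n := by
    have : (addOne ^ n).1 (g.1 y) = g.1 ((addOne ^ n).1 y) :=
      DFunLike.congr_fun (congrArg Subtype.val h.eq) y
    rw [← addOne_pow_apply, ← addOne_pow_apply, this]
  have hsteps (m : ℕ) (y : ℝ) : g.1 (y + m * n) = g.1 y + m * n := by
    induction m with
    | zero => simp
    | succ m ih =>
      have h1 := hstep (y + m * n)
      rw [ih] at h1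
      rw [Nat.cast_succ, add_mul, one_mul, ← add_assoc, ← add_assoc, h1]
  have hlim : Tendsto (fun m : ℕ => x + -(m * n : ℝ)) atTop atBot :=
    tendsto_atBot_add_const_left _ _ (tendsto_neg_atTop_atBot.comp
      (tendsto_natCast_atTop_atTop.atTop_mul_const (by positivity)))
  obtain ⟨m, hm⟩ := (hlim.eventually (eventually_eq_add_shift g)).exists
  have h1 := hsteps m (x + -(m * n : ℝ))
  rw [hm, neg_add_cancel_right] at h1
  rw [h1]
  ring

theorem IsTranslation.eq_one_of_commute {n : ℕ} (hn : n ≠ 0) {g : F} (hg : IsTranslation g)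
    (h : Commute (halve ^ n) g) : g = 1 := by
  have hcomm (y : ℝ) : (halve ^ n).1 (y + shift g) = (halve ^ n).1 y + shift g := by
    have := DFunLike.congr_fun (congrArg Subtype.val h.eq) y
    rw [← hg, ← hg]
    exact this
  have h0 : shift g = 0 := by
    rcases lt_trichotomy (shift g) 0 with hlt | heq | hgt
    · have h1 := hcomm (-shift g)
      have h2 := halve_pow_apply_lt hn (neg_pos.2 hlt)
      rw [neg_add_cancel, halve_pow_apply_zero] at h1
      linarith
    · exact heq
    · have h1 := hcomm 0
      have h2 := halve_pow_apply_lt hn hgt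
      rw [zero_add, halve_pow_apply_zero] at h1
      linarith
  exact hg.ext (fun x => by simp [shift_one]) (h0.trans shift_one.symm)

theorem commute_pow_sub_of_conj_eq {G : Type} [Group G] {c v : G} {k l : ℕ} (hkl : k ≤ l)
    (h : c ^ k * v * (c ^ k)⁻¹ = c ^ l * v * (c ^ l)⁻¹) : Commute (c ^ (l - k)) v := by
  obtain ⟨m, rfl⟩ := Nat.exists_eq_add_of_le hkl
  rw [Nat.add_sub_cancel_left, commute_iff_eq, ← mul_inv_eq_iff_eq_mul]
  have h' : c ^ k * v * (c ^ k)⁻¹ = c ^ k * (c ^ m * v * (c ^ m)⁻¹) * (c ^ k)⁻¹ :=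
    h.trans (by simp only [pow_add, mul_inv_rev, mul_assoc])
  exact (mul_left_cancel (mul_right_cancel h')).symm

theorem subsingleton_isTranslation_conj {u : F} (hu : u ≠ 1) :
    {k : ℕ | IsTranslation (halve ^ k * u * (halve ^ k)⁻¹)}.Subsingleton := by
  have key : ∀ k l : ℕ, IsTranslation (halve ^ k * u * (halve ^ k)⁻¹) →
      IsTranslation (halve ^ l * u * (halve ^ l)⁻¹) → ¬ k < l := by
    intro k l hk hl hkl
    have hcomm : Commute (halve ^ (l - k)) u := commute_pow_sub_of_conj_eq hkl.le
      (hk.ext hl (by rw [shift_conj, shift_conj]))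
    have hcomm' := (Commute.conj_iff (halve ^ k)).2 hcomm
    rw [← pow_add, add_comm, pow_add, mul_inv_cancel_right] at hcomm'
    exact hu (conj_eq_one_iff.1 (hk.eq_one_of_commute (Nat.sub_ne_zero_of_lt hkl) hcomm'))
  intro k hk l hl
  exact le_antisymm (not_lt.1 (key l k hl hk)) (not_lt.1 (key k l hk hl))

theorem hasSpreadingConjugators_shift : HasSpreadingConjugators shift := by
  intro U hU
  have hU' : (U \ {1}).Finite := hU.subset sdiff_subset
  obtain ⟨k, hk⟩ := (hU'.biUnion fun u hu =>
    (subsingleton_isTranslation_conj (u := u) hu.2).finite).exists_notMem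
  simp only [mem_iUnion, not_exists] at hk
  have hfin : (⋃ u ∈ U \ {1}, {n : ℕ |
      addOne ^ n * (halve ^ k * u * (halve ^ k)⁻¹) * (addOne ^ n)⁻¹ ∈ U}).Finite := by
    refine hU'.biUnion fun u hu => hU.preimage (Function.Injective.injOn ?_)
    have key : ∀ m n : ℕ, addOne ^ m * (halve ^ k * u * (halve ^ k)⁻¹) * (addOne ^ m)⁻¹ =
        addOne ^ n * (halve ^ k * u * (halve ^ k)⁻¹) * (addOne ^ n)⁻¹ → ¬ m < n :=
      fun m n h hmn => hk u hu (isTranslation_of_commute (Nat.sub_ne_zero_of_lt hmn)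
        (commute_pow_sub_of_conj_eq hmn.le h))
    exact fun m n h => le_antisymm (not_lt.1 (key n m h.symm)) (not_lt.1 (key m n h))
  obtain ⟨M, hM⟩ := (hU.image fun u => 10 * |shift u|).bddAbove
  have hev := hfin.eventually_cofinite_notMem
  rw [Nat.cofinite_eq_atTop] at hev
  obtain ⟨n, hn, hnM⟩ :=
    (hev.and (tendsto_natCast_atTop_atTop.eventually (eventually_gt_atTop M))).exists
  refine ⟨addOne ^ n * halve ^ k, fun u hu => ?_, fun u hu hconj => ?_⟩
  · rw [shift_mul, shift_pow, shift_pow, shift_addOne, shift_halve, mul_one, mul_zero, add_zero]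
    exact (hM ⟨u, hu, rfl⟩).trans_lt hnM
  · by_contra hu1
    refine hn (mem_biUnion (x := u) ⟨hu, hu1⟩ ?_)
    simpa [mul_assoc] using hconj

instance countable_F : Countable F := by
  have hrange : (FreeGroup.lift ((↑) : ({a, b} : Set (Equiv.Perm ℝ)) → Equiv.Perm ℝ)).range = F := by
    rw [FreeGroup.range_lift_eq_closure, Subtype.range_coe, F]
  have : Countable (FreeGroup ({a, b} : Set (Equiv.Perm ℝ))) :=
    Quot.mk_surjective.countable
  rw [← hrange]
  exact (MonoidHom.rangeRestrict_surjective _).countable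

instance nontrivial_F : Nontrivial F :=
  ⟨addOne, 1, fun h => by simpa [shift_addOne, shift_one] using congrArg shift h⟩

/-- The left translation action of `G` on a translation invariant set of configurations. -/
def translateAction {G : Type} [Group G] {X : Set (G → Bool)}
    (hX : ∀ g, ∀ x ∈ X, (fun h => x (g * h)) ∈ X) : G →* Equiv.Perm X where
  toFun g :=
    { toFun := fun x => ⟨fun h => x.1 (g⁻¹ * h), hX g⁻¹ x.1 x.2⟩
      invFun := fun x => ⟨fun h => x.1 (g * h), hX g x.1 x.2⟩
      left_inv := fun x => by simp
      right_inv := fun x => by simp }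
  map_one' := by
    ext x
    simp
  map_mul' g g' := by
    ext x
    simp [mul_assoc]

end Thompson

/-- Thompson's group `F` is not strongly amenable: there is a nonempty compact
Hausdorff space on which `F` acts by homeomorphisms, such that the action is
proximal but has no fixed point. -/
theorem F_not_stronglyAmenable :
    ∃ (X : Type) (_ : TopologicalSpace X) (σ : F →* Equiv.Perm X),
      Nonempty X ∧ CompactSpace X ∧ T2Space X ∧
      (∀ g : F, Continuous (σ g)) ∧
      (∀ x y : X, ∃ p : X,
        (p, p) ∈ closure {q : X × X | ∃ g : F, q = (σ g x, σ g y)}) ∧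
      (∀ x : X, ∃ g : F, σ g x ≠ x) := by
  obtain ⟨X, hne, hcl, hX, hprox, hmove⟩ :=
    exists_proximal_subshift shift_mul hasSpreadingConjugators_shift
  have hcomp : CompactSpace X := isCompact_iff_compactSpace.1 hcl.isCompact
  refine ⟨X, inferInstance, translateAction hX, hne.to_subtype, hcomp, inferInstance,
    fun g => ?_, fun x y => ?_, fun x => ?_⟩
  · exact Continuous.subtype_mk (continuous_pi fun h =>
      (continuous_apply (A := fun _ : F => Bool) (g⁻¹ * h)).comp continuous_subtype_val) _
  · have hagree (W : Finset F) : IsClosed (⋂ w ∈ W, {q : X × X | q.1.1 w = q.2.1 w}) :=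
      isClosed_biInter fun w _ => isClosed_eq
        ((continuous_apply w).comp (continuous_subtype_val.comp continuous_fst))
        ((continuous_apply w).comp (continuous_subtype_val.comp continuous_snd))
    set K : Set (X × X) :=
      closure {q | ∃ g : F, q = (translateAction hX g x, translateAction hX g y)}
    obtain ⟨⟨p, q⟩, hpq⟩ := IsCompact.nonempty_iInter_of_directed_nonempty_isCompact_isClosed
      (fun W : Finset F => K ∩ ⋂ w ∈ W, {q : X × X | q.1.1 w = q.2.1 w})
      (directed_of_isDirected_le fun W W' hWW' =>
        inter_subset_inter_right _ (biInter_subset_biInter_left hWW'))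
      (fun W => by
        obtain ⟨g, hg⟩ := hprox x x.2 y y.2 W
        refine ⟨_, subset_closure ⟨g⁻¹, rfl⟩, mem_iInter₂.2 fun w hw => ?_⟩
        simpa [translateAction] using hg w hw)
      (fun W => (isClosed_closure.inter (hagree W)).isCompact)
      (fun W => isClosed_closure.inter (hagree W))
    rw [mem_iInter] at hpq
    obtain rfl : p = q := Subtype.ext (funext fun w => mem_iInter₂.1 (hpq {w}).2 w (by simp))
    exact ⟨p, (hpq ∅).1⟩
  · obtain ⟨g, h, hgh⟩ := hmove x x.2
    refine ⟨g⁻¹, fun heq => hgh ?_⟩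
    simpa [translateAction] using congrFun (congrArg Subtype.val heq) h
end
end
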